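/- The 2-sphere Metric.sphere (0 : EuclideanSpace ℝ (Fin 3)) 1, with the subspace topology, admits no circle decomposition. -/

import Mathlib

open Topology Set

/-- A circle in a topological space `X`: a subset homeomorphic to the unit circle. -/
def IsCircle {X : Type*} [TopologicalSpace X] (C : Set X) : Prop :=
  Nonempty (C ≃ₜ Circle)

/-- A circle decomposition of `X`: a set of pairwise disjoint circles whose union is `X`. -/
def IsCircleDecomposition {X : Type*} [TopologicalSpace X] (𝒞 : Set (Set X)) : Prop :=
  (∀ C ∈ 𝒞, IsCircle C) ∧
  (∀ C ∈ 𝒞, ∀ D ∈ 𝒞, C ≠ D → Disjoint C D) ∧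
  ⋃₀ 𝒞 = Set.univ

open Filter unitInterval

/-- Two continuous logarithms of the same function on a preconnected set agree as soon as they
agree at one point. -/
theorem Complex.eqOn_of_exp_eqOn {A : Type*} [TopologicalSpace A] {s : Set A} {f g : A → ℂ}
    (hs : IsPreconnected s) (hf : ContinuousOn f s) (hg : ContinuousOn g s)
    (hfg : ∀ x ∈ s, Complex.exp (f x) = Complex.exp (g x)) {a : A} (ha : a ∈ s)
    (hfga : f a = g a) : EqOn f g s :=
  Complex.isCoveringMap_exp.eqOn_of_comp_eqOn hs hf hg
    (fun x hx ↦ Subtype.ext (hfg x hx)) ha hfga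

/-- There is no continuous logarithm of `z - w` on the punctured plane `{w}ᶜ`. -/
theorem Complex.not_exists_log_sub (w : ℂ) :
    ¬ ∃ g : ℂ → ℂ, ContinuousOn g {w}ᶜ ∧ ∀ z ≠ w, Complex.exp (g z) = z - w := by
  rintro ⟨g, hg, hexp⟩
  have hne (θ : ℝ) : w + Complex.exp (θ * Complex.I) ≠ w := by simp
  have key : EqOn (fun θ : ℝ ↦ g (w + Complex.exp (θ * Complex.I)))
      (fun θ : ℝ ↦ θ * Complex.I + g (w + 1)) univ := by
    refine Complex.eqOn_of_exp_eqOn isPreconnected_univ ?_ (by fun_prop) (fun θ _ ↦ ?_)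
      (mem_univ 0) (by simp)
    · exact hg.comp (by fun_prop) fun θ _ ↦ hne θ
    · rw [hexp _ (hne θ), Complex.exp_add, hexp _ (by simp)]
      simp
  have := key (mem_univ (2 * Real.pi))
  simp [Complex.exp_two_pi_mul_I, Real.pi_ne_zero] at this

section Chart

variable {X : Type*} [TopologicalSpace X] [T2Space X] {q : X}

/-- A chart defined on the complement of a point and onto the plane tends to infinity at the
missing point. -/
theorem OpenPartialHomeomorph.tendsto_cocompact_of_source_eq_compl
    (φ : OpenPartialHomeomorph X ℂ) (hs : φ.source = {q}ᶜ) (ht : φ.target = univ) :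
    Tendsto φ (𝓝[≠] q) (cocompact ℂ) := by
  rw [(hasBasis_cocompact (X := ℂ)).tendsto_right_iff]
  intro K hK
  have hcont : ContinuousOn φ.symm K := φ.continuousOn_symm.mono (by simp [ht])
  have hq : q ∉ φ.symm '' K := by
    rintro ⟨z, -, hz⟩
    have : φ.symm z ∈ φ.source := φ.map_target (by simp [ht])
    simp [hs, hz] at this
  have hmem := (hK.image_of_continuousOn hcont).isClosed.isOpen_compl.mem_nhds hq
  filter_upwards [self_mem_nhdsWithin, mem_nhdsWithin_of_mem_nhds hmem] with x hx hxK hφ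
  exact hxK ⟨φ x, hφ, φ.left_inv (by simpa [hs] using hx)⟩

/-- If the path `a` runs from the point at infinity `q` to `p`, then `z - φ p` has a continuous
logarithm on the complement of the path. -/
theorem OpenPartialHomeomorph.exists_log_sub_of_path
    (φ : OpenPartialHomeomorph X ℂ) (hs : φ.source = {q}ᶜ) (ht : φ.target = univ)
    (a : C(I, X)) (h0 : a 0 = q) (h1 : a 1 ≠ q) :
    ∃ g : ℂ → ℂ, ContinuousOn g {z | φ.symm z ∉ range a} ∧
      ∀ z, φ.symm z ∉ range a → Complex.exp (g z) = z - φ (a 1) := by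
  classical
  by_cases hne : ∃ z₀, φ.symm z₀ ∉ range a
  swap
  · push Not at hne
    exact ⟨0, continuousOn_const, fun z hz ↦ (hz (hne z)).elim⟩
  obtain ⟨z₀, hz₀⟩ := hne
  have hsub {z : ℂ} (hz : φ.symm z ∉ range a) {t : I} (hat : a t ≠ q) : z - φ (a t) ≠ 0 := by
    intro h
    refine hz ⟨t, ?_⟩
    rw [sub_eq_zero.1 h, φ.left_inv (by simpa [hs] using hat)]
  let k : X → ℂ := Function.update (fun x ↦ (z₀ - φ x)⁻¹) q 0
  have hkq : k q = 0 := Function.update_self ..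
  have hk {x : X} (hx : x ≠ q) : k x = (z₀ - φ x)⁻¹ := Function.update_of_ne hx ..
  have hka : Continuous (fun t ↦ k (a t)) := by
    refine continuous_iff_continuousAt.2 fun t ↦
      ContinuousAt.comp (f := a) (g := k) ?_ a.continuous.continuousAt
    by_cases hat : a t = q
    · rw [hat]
      refine continuousAt_update_same.2 (tendsto_inv₀_cobounded.comp ?_)
      have := φ.tendsto_cocompact_of_source_eq_compl hs ht
      rw [← Metric.cobounded_eq_cocompact] at this
      exact tendsto_const_sub_cobounded z₀ |>.comp this
    · refine (continuousAt_update_of_ne hat).2 (ContinuousAt.inv₀ ?_ (hsub hz₀ hat))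
      exact continuousAt_const.sub (φ.continuousAt (by simpa [hs] using hat))
  have hval {z : ℂ} {t : I} (hat : a t ≠ q) :
      1 + (z - z₀) * k (a t) = (z - φ (a t)) / (z₀ - φ (a t)) := by
    have := hsub hz₀ hat
    rw [hk hat]
    field_simp
    ring
  let A : Set ℂ := {z | φ.symm z ∉ range a}
  let H : C(I × A, {z : ℂ // z ≠ 0}) :=
    ⟨fun x ↦ ⟨1 + (x.2 - z₀) * k (a x.1), by
      by_cases hat : a x.1 = q
      · simp [hat, hkq]
      · rw [hval hat]
        exact div_ne_zero (hsub x.2.2 hat) (hsub hz₀ hat)⟩, by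
      have := hka.comp (continuous_fst (X := I) (Y := A))
      refine Continuous.subtype_mk ?_ _
      exact continuous_const.add ((by fun_prop : Continuous fun x : I × A ↦ (x.2 : ℂ) - z₀).mul
        this)⟩
  have H0 (z : A) : H (0, z) = ⟨_, ((0 : C(A, ℂ)) z).exp_ne_zero⟩ :=
    Subtype.ext (by simp [H, h0, hkq])
  let L := Complex.isCoveringMap_exp.liftHomotopy H 0 H0
  have hL (z : A) : Complex.exp (L (1, z)) = (z - φ (a 1)) / (z₀ - φ (a 1)) :=
    (congr_arg Subtype.val
      (congr_fun (Complex.isCoveringMap_exp.liftHomotopy_lifts H 0 H0) (1, z))).trans (hval h1)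
  refine ⟨fun z ↦ if hz : z ∈ A then L (1, ⟨z, hz⟩) + Complex.log (z₀ - φ (a 1)) else 0, ?_,
    fun z hz ↦ ?_⟩
  · rw [continuousOn_iff_continuous_domRestrict]
    have : Continuous fun z : A ↦ L (1, z) + Complex.log (z₀ - φ (a 1)) := by fun_prop
    refine this.congr fun z ↦ ?_
    have hz : (z : ℂ) ∈ A := z.2
    simp [Set.domRestrict, hz]
  · have hzA : z ∈ A := hz
    have := hsub hz₀ h1
    simp only [hzA, dif_pos, Complex.exp_add, hL, Complex.exp_log this]
    field_simp

/-- If two paths from the point at infinity `q` to `p` meet only at their endpoints, then their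
union separates. -/
theorem OpenPartialHomeomorph.not_isPreconnected_compl_range_union_range
    (φ : OpenPartialHomeomorph X ℂ) (hs : φ.source = {q}ᶜ) (ht : φ.target = univ)
    (a b : C(I, X)) (ha0 : a 0 = q) (hb0 : b 0 = q) (h1 : a 1 ≠ q) (hab : b 1 = a 1)
    (hinter : range a ∩ range b ⊆ {a 1, q}) :
    ¬ IsPreconnected (range a ∪ range b)ᶜ := by
  classical
  intro hconn
  obtain ⟨f, hf, hfexp⟩ := φ.exists_log_sub_of_path hs ht a ha0 h1
  obtain ⟨g, hg, hgexp⟩ := φ.exists_log_sub_of_path hs ht b hb0 (hab ▸ h1)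
  rw [hab] at hgexp
  set A : Set ℂ := {z | φ.symm z ∉ range a}
  set B : Set ℂ := {z | φ.symm z ∉ range b}
  have hsymm : Continuous φ.symm := by
    rw [← continuousOn_univ, ← ht]; exact φ.continuousOn_symm
  have hA : IsOpen A := (isCompact_range a.continuous).isClosed.isOpen_compl.preimage hsymm
  have hB : IsOpen B := (isCompact_range b.continuous).isClosed.isOpen_compl.preimage hsymm
  have hAB : IsPreconnected (A ∩ B) := by
    have himage : A ∩ B = φ '' (range a ∪ range b)ᶜ := by
      ext z
      constructor
      · rintro ⟨hzA, hzB⟩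
        exact ⟨φ.symm z, fun h ↦ h.elim hzA hzB, φ.right_inv (by simp [ht])⟩
      · rintro ⟨x, hx, rfl⟩
        have hxq : x ∈ φ.source := by
          rw [hs]; rintro rfl; exact hx (Or.inl ⟨0, ha0⟩)
        simp only [A, B, mem_inter_iff, Set.mem_ofPred_eq, φ.left_inv hxq]
        exact ⟨fun h ↦ hx (Or.inl h), fun h ↦ hx (Or.inr h)⟩
    rw [himage]
    refine hconn.image _ (φ.continuousOn.mono ?_)
    rw [hs]
    rintro x hx rfl
    exact hx (Or.inl ⟨0, ha0⟩)
  obtain ⟨c, hc, hgc⟩ : ∃ c, Complex.exp c = 1 ∧ EqOn f (fun z ↦ g z + c) (A ∩ B) := by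
    rcases (A ∩ B).eq_empty_or_nonempty with he | ⟨w, hw⟩
    · exact ⟨0, by simp, by simp [he]⟩
    have hw0 : Complex.exp (f w - g w) = 1 := by
      rw [Complex.exp_sub, hfexp w hw.1, ← hgexp w hw.2, div_self (Complex.exp_ne_zero _)]
    refine ⟨f w - g w, hw0, Complex.eqOn_of_exp_eqOn hAB (hf.mono inter_subset_left)
      ((hg.mono inter_subset_right).add continuousOn_const) (fun z hz ↦ ?_) hw (by ring)⟩
    rw [Complex.exp_add, hw0, hfexp z hz.1, hgexp z hz.2, mul_one]
  have hcover {z : ℂ} (hz : z ≠ φ (a 1)) (hzA : z ∉ A) : z ∈ B := by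
    by_contra hzB
    rcases hinter ⟨not_not.1 hzA, not_not.1 hzB⟩ with h | h
    · exact hz (by rw [← h, φ.right_inv (by simp [ht])])
    · have : φ.symm z ∈ φ.source := φ.map_target (by simp [ht])
      simp [hs, mem_singleton_iff.1 h] at this
  refine Complex.not_exists_log_sub (φ (a 1)) ⟨fun z ↦ if z ∈ A then f z else g z + c, ?_, ?_⟩
  · intro z hz
    refine ContinuousAt.continuousWithinAt ?_
    by_cases hzA : z ∈ A
    · refine (hf.continuousAt (hA.mem_nhds hzA)).congr ?_
      filter_upwards [hA.mem_nhds hzA] with w hw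
      simp [hw]
    · have hzB := hcover hz hzA
      refine ((hg.continuousAt (hB.mem_nhds hzB)).add (continuousAt_const (y := c))).congr ?_
      filter_upwards [hB.mem_nhds hzB] with w hw
      by_cases hwA : w ∈ A
      · simpa [hwA] using (hgc ⟨hwA, hw⟩).symm
      · simp [hwA]
  · intro z hz
    by_cases hzA : z ∈ A
    · simp [hzA, hfexp z hzA]
    · simp [hzA, Complex.exp_add, hc, hgexp z (hcover hz hzA)]

end Chart

/-- The unit circle is the union of two paths from `-1` to `1` that meet only at their endpoints. -/
theorem Circle.exists_two_arcs : ∃ a b : C(I, Circle), a 0 = Circle.exp Real.pi ∧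
    b 0 = Circle.exp Real.pi ∧ a 1 = 1 ∧ b 1 = 1 ∧ range a ∪ range b = univ ∧
    range a ∩ range b ⊆ {1, Circle.exp Real.pi} := by
  have hpi := Real.pi_pos
  refine ⟨⟨fun t ↦ Circle.exp (Real.pi * (1 - t)), by fun_prop⟩,
    ⟨fun t ↦ Circle.exp (-(Real.pi * (1 - t))), by fun_prop⟩, by simp, ?_, by simp, by simp,
    eq_univ_of_forall fun w ↦ ?_, ?_⟩
  · change Circle.exp (-(Real.pi * (1 - (0 : ℝ)))) = _
    simpa using (Circle.periodic_exp (-Real.pi)).symm.trans (by ring_nf)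
  · have h₁ := Complex.neg_pi_lt_arg (w : ℂ)
    have h₂ := Complex.arg_le_pi (w : ℂ)
    rcases le_total 0 (Complex.arg w) with h | h
    · refine Or.inl ⟨⟨1 - Complex.arg w / Real.pi, ?_, ?_⟩, ?_⟩
      · rw [sub_nonneg, div_le_one hpi]; exact h₂
      · linarith [div_nonneg h hpi.le]
      · simp [mul_div_cancel₀ _ hpi.ne', Circle.exp_arg]
    · refine Or.inr ⟨⟨1 + Complex.arg w / Real.pi, ?_, ?_⟩, ?_⟩
      · rw [← neg_le_iff_add_nonneg', le_div_iff₀ hpi]; linarith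
      · linarith [div_nonpos_of_nonpos_of_nonneg h hpi.le]
      · simp [mul_div_cancel₀ _ hpi.ne', Circle.exp_arg]
  · rintro w ⟨⟨s, rfl⟩, ⟨t, ht⟩⟩
    have hI (r : I) : 0 ≤ Real.pi * (1 - r) ∧ Real.pi * (1 - r) ≤ Real.pi :=
      ⟨mul_nonneg hpi.le (sub_nonneg.2 r.2.2), mul_le_of_le_one_right hpi.le (by linarith [r.2.1])⟩
    have him := congr_arg (fun w : Circle ↦ (w : ℂ).im) ht
    simp only [ContinuousMap.coe_mk, Circle.coe_exp, Complex.exp_ofReal_mul_I_im,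
      Real.sin_neg] at him
    have hsin := Real.sin_nonneg_of_nonneg_of_le_pi (hI t).1 (hI t).2
    rcases (hI s).1.eq_or_lt with h | h
    · simp [← h]
    rcases (hI s).2.eq_or_lt with h' | h'
    · simp [h']
    linarith [Real.sin_pos_of_pos_of_lt_pi h h']

/-- **Jordan separation**: circles separate a Hausdorff space all of whose one-point complements
are planes. -/
theorem IsCircle.not_isPreconnected_compl {X : Type*} [TopologicalSpace X] [T2Space X]
    (hX : ∀ q : X, ∃ φ : OpenPartialHomeomorph X ℂ, φ.source = {q}ᶜ ∧ φ.target = univ)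
    {C : Set X} (hC : IsCircle C) : ¬ IsPreconnected Cᶜ := by
  obtain ⟨h⟩ := hC
  obtain ⟨a, b, ha0, hb0, ha1, hb1, hunion, hinter⟩ := Circle.exists_two_arcs
  let ι : C(Circle, X) := ⟨fun w ↦ h.symm w, by fun_prop⟩
  have hι : Function.Injective ι := Subtype.val_injective.comp h.symm.injective
  have hrange : range ι = C := by
    have : range ι = range (Subtype.val ∘ h.symm) := rfl
    rw [this, h.symm.surjective.range_comp, Subtype.range_val]
  obtain ⟨φ, hs, ht⟩ := hX (ι (Circle.exp Real.pi))
  have hr (c : C(I, Circle)) : range (ι.comp c) = ι '' range c := by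
    rw [ContinuousMap.coe_comp, range_comp]
  have key := φ.not_isPreconnected_compl_range_union_range hs ht (ι.comp a) (ι.comp b)
    (by simp [ha0]) (by simp [hb0]) ?_ (by simp [ha1, hb1]) ?_
  · rwa [hr, hr, ← image_union, hunion, image_univ, hrange] at key
  · have : (1 : Circle) ≠ Circle.exp Real.pi := by
      intro h
      have := congr_arg (fun w : Circle ↦ (w : ℂ)) h
      norm_num [Circle.coe_exp, Complex.exp_pi_mul_I] at this
    simpa [ha1] using hι.ne this
  · rw [hr, hr, ← image_inter hι]
    simpa [image_pair, ha1] using image_mono (f := ι) hinter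

section Filling

variable {X : Type*} [TopologicalSpace X] {p : X} {C D : Set X}

/-- The filling of `C` relative to `p`: the complement of the component of `Cᶜ` at `p`. -/
def filling (p : X) (C : Set X) : Set X := (connectedComponentIn Cᶜ p)ᶜ

theorem subset_filling : C ⊆ filling p C :=
  subset_compl_comm.1 (connectedComponentIn_subset _ _)

theorem notMem_filling (hp : p ∉ C) : p ∉ filling p C :=
  not_not.2 (mem_connectedComponentIn hp)

theorem filling_subset_filling (hp : p ∉ C) (hD : D ⊆ filling p C) : filling p D ⊆ filling p C :=
  compl_subset_compl.2 (isPreconnected_connectedComponentIn.subset_connectedComponentIn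
    (mem_connectedComponentIn hp) (subset_compl_comm.1 hD))

theorem subset_filling_of_mem (hD : IsPreconnected D) (hCD : Disjoint C D) {x : X} (hxD : x ∈ D)
    (hx : x ∈ filling p C) : D ⊆ filling p C := by
  intro y hyD hy
  have hsub := hD.subset_connectedComponentIn hyD hCD.subset_compl_left
  rw [← connectedComponentIn_eq hy] at hsub
  exact hx (hsub hxD)

theorem isClosed_filling [LocallyConnectedSpace X] (hC : IsClosed C) : IsClosed (filling p C) :=
  hC.isOpen_compl.connectedComponentIn.isClosed_compl

theorem frontier_filling_subset [LocallyConnectedSpace X] (hC : IsClosed C) :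
    frontier (filling p C) ⊆ C := by
  intro x hx
  by_contra hxC
  have hopen : IsOpen (connectedComponentIn Cᶜ x) := hC.isOpen_compl.connectedComponentIn
  rw [filling, frontier_compl] at hx
  have hcl := frontier_subset_closure hx
  obtain ⟨y, hyx, hyp⟩ := mem_closure_iff.1 hcl _ hopen (mem_connectedComponentIn hxC)
  have heq := (connectedComponentIn_eq hyx).trans (connectedComponentIn_eq hyp).symm
  have hxp : x ∈ connectedComponentIn Cᶜ p := heq ▸ mem_connectedComponentIn hxC
  exact hx.2 ((hC.isOpen_compl.connectedComponentIn.interior_eq).symm ▸ hxp)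

end Filling

theorem IsCircle.isConnected {X : Type*} [TopologicalSpace X] {C : Set X} (hC : IsCircle C) :
    IsConnected C := by
  obtain ⟨h⟩ := hC
  have : ConnectedSpace C := h.symm.surjective.connectedSpace h.symm.continuous
  exact isConnected_iff_connectedSpace.2 this

theorem IsCircle.isCompact {X : Type*} [TopologicalSpace X] {C : Set X} (hC : IsCircle C) :
    IsCompact C := by
  obtain ⟨h⟩ := hC
  exact isCompact_iff_compactSpace.2 h.symm.compactSpace

/-- A compact connected locally connected Hausdorff space separated by each of its circles has no
circle decomposition. -/
theorem not_exists_isCircleDecomposition {X : Type*} [TopologicalSpace X] [T2Space X]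
    [CompactSpace X] [ConnectedSpace X] [LocallyConnectedSpace X]
    (hX : ∀ C : Set X, IsCircle C → ¬ IsPreconnected Cᶜ) :
    ¬ ∃ 𝒞 : Set (Set X), IsCircleDecomposition 𝒞 := by
  rintro ⟨𝒞, hcirc, hdisj, hcover⟩
  have hex (x : X) : ∃ C ∈ 𝒞, x ∈ C := by
    simpa using hcover.ge (mem_univ x)
  have hclosed {C : Set X} (hC : C ∈ 𝒞) : IsClosed C := (hcirc C hC).isCompact.isClosed
  obtain ⟨p⟩ : Nonempty X := inferInstance
  let S : Set (Set X) := {C | C ∈ 𝒞 ∧ p ∉ C}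
  have hmem {C : Set X} (hC : C ∈ S) {x : X} (hx : x ∈ filling p C) :
      ∃ D ∈ S, x ∈ D ∧ filling p D ⊆ filling p C := by
    obtain ⟨D, hD, hxD⟩ := hex x
    have hsub : D ⊆ filling p C := by
      by_cases hCD : C = D
      · exact hCD ▸ subset_filling
      · exact subset_filling_of_mem (hcirc D hD).isConnected.isPreconnected
          (hdisj C hC.1 D hD hCD) hxD hx
    exact ⟨D, ⟨hD, fun h ↦ notMem_filling hC.2 (hsub h)⟩, hxD,
      filling_subset_filling hC.2 hsub⟩
  have huniq {C D : Set X} (hC : C ∈ 𝒞) (hD : D ∈ 𝒞) {x : X} (hxC : x ∈ C) (hxD : x ∈ D) :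
      C = D := by
    by_contra hne
    exact disjoint_left.1 (hdisj C hC D hD hne) hxC hxD
  obtain ⟨m, ⟨C, hC, rfl⟩, hmin⟩ : ∃ m, Minimal (· ∈ filling p '' S) m := by
    refine zorn_superset _ fun c hc hchain ↦ ?_
    rcases c.eq_empty_or_nonempty with rfl | hne
    · obtain ⟨C₀, hC₀, hpC₀⟩ := hex p
      obtain ⟨x, hx⟩ : C₀ᶜ.Nonempty := by
        by_contra h
        exact hX C₀ (hcirc C₀ hC₀) (not_nonempty_iff_eq_empty.1 h ▸ isPreconnected_empty)
      obtain ⟨D, hD, hxD⟩ := hex x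
      exact ⟨_, ⟨D, ⟨hD, fun h ↦ hx (huniq hC₀ hD hpC₀ h ▸ hxD)⟩, rfl⟩, by simp⟩
    · have hcl : ∀ s ∈ c, IsClosed s := by
        intro s hs
        obtain ⟨C, hC, rfl⟩ := hc hs
        exact isClosed_filling (hclosed hC.1)
      have : Nonempty c := hne.to_subtype
      have hdir : DirectedOn (fun s t : Set X ↦ s ⊇ t) c := fun s hs t ht ↦
        (hchain.total hs ht).elim (fun h ↦ ⟨s, hs, subset_rfl, h⟩) fun h ↦ ⟨t, ht, h, subset_rfl⟩
      obtain ⟨x, hx⟩ : (⋂₀ c).Nonempty := by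
        refine IsCompact.nonempty_sInter_of_directed_nonempty_isCompact_isClosed
          hdir ?_ (fun s hs ↦ (hcl s hs).isCompact) hcl
        intro s hs
        obtain ⟨C, hC, rfl⟩ := hc hs
        exact (hcirc C hC.1).isConnected.nonempty.mono subset_filling
      obtain ⟨s, hs⟩ := hne
      obtain ⟨C, hC, rfl⟩ := hc hs
      obtain ⟨D, hD, hxD, -⟩ := hmem hC (hx _ hs)
      refine ⟨_, ⟨D, hD, rfl⟩, fun s hs ↦ ?_⟩
      obtain ⟨C', hC', rfl⟩ := hc hs
      obtain ⟨D', hD', hxD', hsub⟩ := hmem hC' (hx _ hs)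
      rwa [huniq hD.1 hD'.1 hxD hxD']
  obtain ⟨x, hx, hxC⟩ : ∃ x ∈ filling p C, x ∉ C := by
    by_contra! h
    have : filling p C = C := Subset.antisymm h subset_filling
    refine hX C (hcirc C hC.1) ?_
    rw [← this, filling, compl_compl]
    exact isPreconnected_connectedComponentIn
  obtain ⟨D, hD, hxD, hsub⟩ := hmem hC hx
  have heq : filling p D = filling p C := hsub.antisymm (hmin ⟨D, hD, rfl⟩ hsub)
  have hCD : Disjoint C D := hdisj C hC.1 D hD.1 fun h ↦ hxC (h ▸ hxD)
  have hfr : frontier (filling p C) = ∅ := by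
    refine subset_empty_iff.1 fun y hy ↦ disjoint_left.1 hCD
      (frontier_filling_subset (hclosed hC.1) hy) ?_
    exact frontier_filling_subset (hclosed hD.1) (heq ▸ hy)
  rcases isClopen_iff.1 (isClopen_iff_frontier_eq_empty.2 hfr) with h | h
  · simp [h] at hx
  · exact notMem_filling hC.2 (h ▸ mem_univ p)

/-- The 2-sphere admits no circle decomposition. -/
theorem sphere_no_circle_decomposition :
    ¬ ∃ 𝒞 : Set (Set (Metric.sphere (0 : EuclideanSpace ℝ (Fin 3)) 1)),
      IsCircleDecomposition 𝒞 := by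
  have : Fact (Module.finrank ℝ (EuclideanSpace ℝ (Fin 3)) = 2 + 1) := ⟨by simp⟩
  have : LocallyConnectedSpace (Metric.sphere (0 : EuclideanSpace ℝ (Fin 3)) 1) :=
    ChartedSpace.locallyConnectedSpace (EuclideanSpace ℝ (Fin 2)) _
  have : ConnectedSpace (Metric.sphere (0 : EuclideanSpace ℝ (Fin 3)) 1) := by
    refine isConnected_iff_connectedSpace.1 (isConnected_sphere ?_ 0 zero_le_one)
    rw [← Module.finrank_eq_rank]
    norm_num
  refine not_exists_isCircleDecomposition fun C hC ↦ hC.not_isPreconnected_compl fun q ↦ ?_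
  refine ⟨(stereographic' 2 q).trans
    Complex.orthonormalBasisOneI.repr.symm.toHomeomorph.toOpenPartialHomeomorph, ?_, ?_⟩
  · simp
  · simp
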